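/- Let G be a bipartite graph with parts U and V, let ξ ∈ (0,1), let X ⊆ V be nonempty and ξ-balanced, and suppose |X| ≥ 24 log n where n is a given integer with n ≥ 2. Let X' ⊆ X be a random subset including each vertex of X independently with probability 1/2. Then with probability at least 1 − 4/n, both |X'| ≤ 3|X|/4 and |e(X') − e(X)/2| ≤ √(ξ log n) · e(X), where e(Y) denotes the number of edges of G incident to Y. -/

import Mathlib

/-- Number of edges of the bipartite graph `E ⊆ U × V` incident to a set `X ⊆ V`. -/
def eInc {U V : Type} [DecidableEq U] [DecidableEq V] (E : Finset (U × V)) (X : Finset V) : ℕ :=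
  (E.filter (fun p => p.2 ∈ X)).card

/-- Degree of a vertex `v ∈ V` in the bipartite graph `E ⊆ U × V`. -/
def bideg {U V : Type} [DecidableEq U] [DecidableEq V] (E : Finset (U × V)) (v : V) : ℕ :=
  (E.filter (fun p => p.2 = v)).card

lemma sum_exp_subset_deviation_le {V : Type*} [DecidableEq V] (X : Finset V) (d : V → ℝ) (s : ℝ) :
    ∑ S ∈ X.powerset, Real.exp (s * (∑ v ∈ S, d v - (∑ v ∈ X, d v) / 2)) ≤
      2 ^ X.card * Real.exp (s ^ 2 * (∑ v ∈ X, d v ^ 2) / 8) := by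
  have hterm : ∀ S ∈ X.powerset, Real.exp (s * (∑ v ∈ S, d v - (∑ v ∈ X, d v) / 2)) =
      (∏ v ∈ S, Real.exp (s * d v / 2)) * ∏ v ∈ X \ S, Real.exp (-(s * d v / 2)) := by
    intro S hS
    rw [← Real.exp_sum, ← Real.exp_sum, ← Real.exp_add,
      ← Finset.sum_sdiff (Finset.mem_powerset.mp hS), Finset.sum_neg_distrib,
      ← Finset.sum_div, ← Finset.sum_div, ← Finset.mul_sum, ← Finset.mul_sum]
    ring_nf
  rw [Finset.sum_congr rfl hterm, ← Finset.prod_add]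
  calc ∏ v ∈ X, (Real.exp (s * d v / 2) + Real.exp (-(s * d v / 2)))
      ≤ ∏ v ∈ X, (2 * Real.exp ((s * d v / 2) ^ 2 / 2)) := by
        refine Finset.prod_le_prod (fun v _ => by positivity) fun v _ => ?_
        have h := Real.cosh_le_exp_half_sq (s * d v / 2)
        rw [Real.cosh_eq] at h
        linarith
    _ = 2 ^ X.card * Real.exp (s ^ 2 * (∑ v ∈ X, d v ^ 2) / 8) := by
        rw [Finset.prod_mul_distrib, Finset.prod_const, ← Real.exp_sum, Finset.mul_sum,
          Finset.sum_div]
        congr 3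
        ext v
        ring

open Classical in
/-- Hoeffding's inequality for the total weight of a uniformly random subset. -/
lemma card_subset_deviation_ge_le {V : Type*} (X : Finset V) (d : V → ℝ) {D t : ℝ}
    (hD : 0 < D) (hd : ∑ v ∈ X, d v ^ 2 ≤ D) (ht : 0 ≤ t) :
    ((X.powerset.filter (fun S => t ≤ ∑ v ∈ S, d v - (∑ v ∈ X, d v) / 2)).card : ℝ) ≤
      2 ^ X.card * Real.exp (-(2 * t ^ 2 / D)) := by
  set s : ℝ := 4 * t / D with hs
  have hs0 : 0 ≤ s := by positivity
  have hmarkov :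
      ((X.powerset.filter (fun S => t ≤ ∑ v ∈ S, d v - (∑ v ∈ X, d v) / 2)).card : ℝ) *
        Real.exp (s * t) ≤
      ∑ S ∈ X.powerset, Real.exp (s * (∑ v ∈ S, d v - (∑ v ∈ X, d v) / 2)) := by
    rw [← nsmul_eq_mul]
    refine (Finset.card_nsmul_le_sum _ _ _ fun S hS => ?_).trans
      (Finset.sum_le_sum_of_subset_of_nonneg (Finset.filter_subset _ _)
        fun _ _ _ => (Real.exp_pos _).le)
    exact Real.exp_le_exp.mpr (mul_le_mul_of_nonneg_left (Finset.mem_filter.mp hS).2 hs0)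
  have hmgf := hmarkov.trans (sum_exp_subset_deviation_le X d s)
  have hexp : Real.exp (s ^ 2 * (∑ v ∈ X, d v ^ 2) / 8) ≤ Real.exp (s ^ 2 * D / 8) := by
    gcongr
  rw [← le_div_iff₀ (Real.exp_pos _)] at hmgf
  refine hmgf.trans ?_
  rw [mul_div_assoc, ← Real.exp_sub]
  gcongr
  have hst : s ^ 2 * D / 8 - s * t = -(2 * t ^ 2 / D) := by
    rw [hs]
    field_simp
    ring
  rw [← hst]
  gcongr

lemma eInc_eq_sum_bideg {U V : Type} [DecidableEq U] [DecidableEq V] (E : Finset (U × V))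
    (S : Finset V) : eInc E S = ∑ v ∈ S, bideg E v := by
  unfold eInc bideg
  rw [Finset.card_eq_sum_card_fiberwise (s := E.filter (fun p => p.2 ∈ S)) (f := Prod.snd) (t := S)
    (fun p hp => (Finset.mem_filter.mp (Finset.mem_coe.mp hp)).2)]
  refine Finset.sum_congr rfl fun v hv => ?_
  rw [Finset.filter_filter]
  congr 1
  ext p
  simp only [Finset.mem_filter]
  exact ⟨fun h => ⟨h.1, h.2.2⟩, fun h => ⟨h.1, h.2 ▸ hv, h.2⟩⟩

open Classical in
lemma card_abs_deviation_gt_le {V : Type*} (X : Finset V) (d : V → ℝ) {D t : ℝ}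
    (hD : 0 < D) (hd : ∑ v ∈ X, d v ^ 2 ≤ D) (ht : 0 ≤ t) :
    ((X.powerset.filter (fun S => t < |∑ v ∈ S, d v - (∑ v ∈ X, d v) / 2|)).card : ℝ) ≤
      2 * (2 ^ X.card * Real.exp (-(2 * t ^ 2 / D))) := by
  have hupper := card_subset_deviation_ge_le X d hD hd ht
  have hlower := card_subset_deviation_ge_le X (fun v => -d v) hD (by simpa using hd) ht
  have hsub : X.powerset.filter (fun S => t < |∑ v ∈ S, d v - (∑ v ∈ X, d v) / 2|) ⊆
      X.powerset.filter (fun S => t ≤ ∑ v ∈ S, d v - (∑ v ∈ X, d v) / 2) ∪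
      X.powerset.filter (fun S => t ≤ ∑ v ∈ S, -d v - (∑ v ∈ X, -d v) / 2) := by
    intro S hS
    rw [Finset.mem_filter, lt_abs] at hS
    simp only [Finset.mem_union, Finset.mem_filter, Finset.sum_neg_distrib]
    rcases hS with ⟨hS, h | h⟩
    · exact Or.inl ⟨hS, h.le⟩
    · exact Or.inr ⟨hS, by linarith⟩
  have hcard : ((X.powerset.filter
      (fun S => t < |∑ v ∈ S, d v - (∑ v ∈ X, d v) / 2|)).card : ℝ) ≤ _ :=
    Nat.cast_le.mpr ((Finset.card_le_card hsub).trans (Finset.card_union_le _ _))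
  push_cast at hcard
  linarith

open Classical in
lemma card_subset_card_gt_le {V : Type*} (X : Finset V) (hX : X.Nonempty) :
    ((X.powerset.filter (fun S => 3 * (X.card : ℝ) / 4 < (S.card : ℝ))).card : ℝ) ≤
      2 ^ X.card * Real.exp (-((X.card : ℝ) / 8)) := by
  have hpos : (0 : ℝ) < X.card := by exact_mod_cast hX.card_pos
  have h := card_subset_deviation_ge_le X (fun _ => 1) (D := X.card) (t := X.card / 4)
    hpos (by simp) (by positivity)
  have hexp : 2 * ((X.card : ℝ) / 4) ^ 2 / X.card = X.card / 8 := by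
    field_simp
    norm_num
  rw [hexp] at h
  refine le_trans (Nat.cast_le.mpr (Finset.card_le_card fun S hS => ?_)) h
  simp only [Finset.mem_filter, Finset.sum_const, nsmul_eq_mul, mul_one] at hS ⊢
  exact ⟨hS.1, by linarith [hS.2]⟩

open Classical in
lemma card_eInc_deviation_gt_le {U V : Type} [DecidableEq U] [DecidableEq V]
    (E : Finset (U × V)) (X : Finset V) {ξ L : ℝ} (hξ : 0 < ξ) (hL : 0 ≤ L)
    (hbal : ∀ v ∈ X, (bideg E v : ℝ) ≤ ξ * (eInc E X : ℝ)) :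
    ((X.powerset.filter (fun S => Real.sqrt (ξ * L) * (eInc E X : ℝ) <
        |(eInc E S : ℝ) - (eInc E X : ℝ) / 2|)).card : ℝ) ≤
      2 * (2 ^ X.card * Real.exp (-(2 * L))) := by
  have hsum : ∀ S : Finset V, (eInc E S : ℝ) = ∑ v ∈ S, (bideg E v : ℝ) := fun S => by
    rw [eInc_eq_sum_bideg, Nat.cast_sum]
  rcases Nat.eq_zero_or_pos (eInc E X) with he | he
  · rw [Finset.filter_false_of_mem]
    · rw [Finset.card_empty, Nat.cast_zero]
      positivity
    · intro S hS
      have hle : eInc E S ≤ eInc E X := by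
        rw [eInc_eq_sum_bideg, eInc_eq_sum_bideg]
        exact Finset.sum_le_sum_of_subset (Finset.mem_powerset.mp hS)
      have hS0 : eInc E S = 0 := by omega
      simp [he, hS0]
  · have he' : (0 : ℝ) < eInc E X := by exact_mod_cast he
    have hsq : ∑ v ∈ X, (bideg E v : ℝ) ^ 2 ≤ ξ * (eInc E X : ℝ) ^ 2 := by
      calc ∑ v ∈ X, (bideg E v : ℝ) ^ 2
          ≤ ∑ v ∈ X, ξ * (eInc E X : ℝ) * (bideg E v : ℝ) :=
            Finset.sum_le_sum fun v hv => by
              rw [sq]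
              exact mul_le_mul_of_nonneg_right (hbal v hv) (Nat.cast_nonneg _)
        _ = ξ * (eInc E X : ℝ) ^ 2 := by
            rw [← Finset.mul_sum, ← hsum]
            ring
    have h := card_abs_deviation_gt_le X (fun v => (bideg E v : ℝ))
      (D := ξ * (eInc E X : ℝ) ^ 2) (t := Real.sqrt (ξ * L) * (eInc E X : ℝ))
      (by positivity) hsq (by positivity)
    have hexp : 2 * (Real.sqrt (ξ * L) * (eInc E X : ℝ)) ^ 2 / (ξ * (eInc E X : ℝ) ^ 2) =
        2 * L := by
      rw [mul_pow, Real.sq_sqrt (by positivity)]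
      field_simp
    rw [hexp] at h
    simpa only [← hsum] using h

open Classical in
/-- if `X ⊆ V` is nonempty, `ξ`-balanced (every vertex of `X` has degree at most
`ξ e(X)`) and `|X| ≥ 24 log n` (with `n ≥ 2`), then a uniformly random subset `X' ⊆ X`
(each vertex kept independently with probability `1/2`, i.e. uniform over the powerset of `X`)
satisfies, with probability at least `1 - 4/n`, both `|X'| ≤ 3|X|/4` and
`|e(X') - e(X)/2| ≤ √(ξ log n) · e(X)`. -/
theorem stmt2 {U V : Type} [Fintype U] [Fintype V] [DecidableEq U] [DecidableEq V]
    (E : Finset (U × V)) (n : ℕ) (hn : 2 ≤ n) (ξ : ℝ) (hξ0 : 0 < ξ) (hξ1 : ξ < 1)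
    (X : Finset V) (hX : X.Nonempty)
    (hbal : ∀ v ∈ X, (bideg E v : ℝ) ≤ ξ * (eInc E X : ℝ))
    (hsize : 24 * Real.log n ≤ (X.card : ℝ)) :
    1 - 4 / (n : ℝ) ≤
      ((X.powerset.filter (fun X' =>
          ((X'.card : ℝ) ≤ 3 * (X.card : ℝ) / 4) ∧
          |(eInc E X' : ℝ) - (eInc E X : ℝ) / 2| ≤
            Real.sqrt (ξ * Real.log n) * (eInc E X : ℝ))).card : ℝ)
        / (2 : ℝ) ^ X.card := by
  have hn0 : (0 : ℝ) < n := by positivity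
  have hlog : 0 ≤ Real.log n := Real.log_natCast_nonneg n
  have hpow : (0 : ℝ) < 2 ^ X.card := by positivity
  have hinv : ∀ {a : ℝ}, Real.log n ≤ a → Real.exp (-a) ≤ 1 / (n : ℝ) := fun ha => by
    rw [one_div, ← Real.exp_log (inv_pos.mpr hn0), Real.log_inv]
    exact Real.exp_le_exp.mpr (neg_le_neg ha)
  have hcard := (card_subset_card_gt_le X hX).trans
    (mul_le_mul_of_nonneg_left (hinv (by linarith)) hpow.le)
  have hdev := (card_eInc_deviation_gt_le E X hξ0 hlog hbal).trans
    (mul_le_mul_of_nonneg_left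
      (mul_le_mul_of_nonneg_left (hinv (by linarith)) hpow.le) zero_le_two)
  set good : Finset V → Prop := fun X' =>
    ((X'.card : ℝ) ≤ 3 * (X.card : ℝ) / 4) ∧
      |(eInc E X' : ℝ) - (eInc E X : ℝ) / 2| ≤
        Real.sqrt (ξ * Real.log n) * (eInc E X : ℝ) with hgood
  have hsub : X.powerset ⊆ X.powerset.filter good ∪
      (X.powerset.filter (fun S => 3 * (X.card : ℝ) / 4 < (S.card : ℝ)) ∪
        X.powerset.filter (fun S => Real.sqrt (ξ * Real.log n) * (eInc E X : ℝ) <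
          |(eInc E S : ℝ) - (eInc E X : ℝ) / 2|)) := by
    intro S hS
    simp only [Finset.mem_union, Finset.mem_filter, hS, true_and, hgood, ← not_le]
    tauto
  have htotal : ((X.powerset.card : ℕ) : ℝ) ≤ _ :=
    Nat.cast_le.mpr ((Finset.card_le_card hsub).trans ((Finset.card_union_le _ _).trans
      (Nat.add_le_add_left (Finset.card_union_le _ _) _)))
  rw [Finset.card_powerset] at htotal
  push_cast at htotal
  rw [le_div_iff₀ hpow]
  have hfrac : 0 ≤ 2 ^ X.card * (1 / (n : ℝ)) := by positivity
  have hrw : (1 - 4 / (n : ℝ)) * 2 ^ X.card =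
      2 ^ X.card - 4 * (2 ^ X.card * (1 / (n : ℝ))) := by ring
  rw [hrw]
  linarith
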